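/- For |q|<1, Σ_{n∈ℤ} (-1)^n q^{n²+3n}/(1+q^{3n})² = q J_{3,18}⁵ J₆² J_{9,18}³/(2 J₁₈⁶) + (1 − 2q J_{3,18}/J_{9,18})·Σ_{n∈ℤ} (-1)^n q^{9n²+9n}/(1+q^{9n})². -/

import Mathlib

open scoped BigOperators

noncomputable def poch (a q : ℂ) : ℂ := ∏' n : ℕ, (1 - a * q ^ n)

noncomputable def Jm (m : ℕ) (q : ℂ) : ℂ := poch (q ^ m) (q ^ m)

noncomputable def Jam (a m : ℕ) (q : ℂ) : ℂ :=
  poch (q ^ a) (q ^ m) * poch (q ^ (m - a)) (q ^ m) * poch (q ^ m) (q ^ m)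

noncomputable def Sser (a Q : ℂ) : ℂ :=
  ∑' n : ℕ, (1 / (1 - a * Q ^ n) - 1 / (1 - a⁻¹ * Q ^ (n + 1)))

lemma poch_summable (a : ℂ) {t : ℂ} (ht : ‖t‖ < 1) : Summable fun n : ℕ ↦ ‖-(a * t ^ n)‖ := by
  simpa using (summable_geometric_of_lt_one (norm_nonneg _) ht).mul_left ‖a‖

lemma poch_multipliable (a : ℂ) {t : ℂ} (ht : ‖t‖ < 1) :
    Multipliable fun n : ℕ ↦ 1 - a * t ^ n := by
  simpa [sub_eq_add_neg] using multipliable_one_add_of_summable (poch_summable a ht)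

lemma poch_ne_zero {a t : ℂ} (ht : ‖t‖ < 1) (h : ∀ n : ℕ, a * t ^ n ≠ 1) : poch a t ≠ 0 := by
  have := tprod_one_add_ne_zero_of_summable (f := fun n : ℕ ↦ -(a * t ^ n))
    (fun n ↦ by rw [← sub_eq_add_neg, sub_ne_zero]; exact (h n).symm) (poch_summable a ht)
  simpa [poch, sub_eq_add_neg] using this

lemma poch_ne_zero_of_norm_lt_one {a t : ℂ} (ht : ‖t‖ < 1) (ha : ‖a‖ < 1) : poch a t ≠ 0 := by
  refine poch_ne_zero ht fun n h ↦ ?_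
  have : ‖a * t ^ n‖ < 1 := by
    rw [norm_mul, norm_pow]
    exact (mul_le_of_le_one_right (norm_nonneg _) (pow_le_one₀ (norm_nonneg _) ht.le)).trans_lt ha
  simp [h] at this

lemma poch_succ (a : ℂ) {t : ℂ} (ht : ‖t‖ < 1) : poch a t = (1 - a) * poch (a * t) t := by
  have h := tprod_eq_zero_mul' (f := fun n : ℕ ↦ 1 - a * t ^ n) <| by
    simpa [pow_succ', mul_assoc] using poch_multipliable (a * t) ht
  simpa [poch, pow_succ', mul_assoc] using h

lemma poch_mul_poch_neg (a : ℂ) {t : ℂ} (ht : ‖t‖ < 1) :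
    poch a t * poch (-a) t = poch (a ^ 2) (t ^ 2) := by
  rw [poch, poch, poch, ← (poch_multipliable a ht).tprod_mul (poch_multipliable (-a) ht)]
  exact tprod_congr fun n ↦ by ring

lemma poch_even_mul_odd (a : ℂ) {t : ℂ} (ht : ‖t‖ < 1) :
    poch a t = poch a (t ^ 2) * poch (a * t) (t ^ 2) := by
  have ht2 : ‖t ^ 2‖ < 1 := by rw [norm_pow]; exact pow_lt_one₀ (norm_nonneg _) ht two_ne_zero
  have h := tprod_even_mul_odd (f := fun n : ℕ ↦ 1 - a * t ^ n)
    (by simpa [pow_mul] using poch_multipliable a ht2)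
    (by simpa [pow_mul, pow_succ', mul_assoc] using poch_multipliable (a * t) ht2)
  rw [poch, ← h]
  simp [poch, pow_mul, pow_succ', mul_assoc]

lemma poch_split_three (a : ℂ) {t : ℂ} (ht : ‖t‖ < 1) :
    poch a t = poch a (t ^ 3) * poch (a * t) (t ^ 3) * poch (a * t ^ 2) (t ^ 3) := by
  have ht3 : ‖t ^ 3‖ < 1 := by rw [norm_pow]; exact pow_lt_one₀ (norm_nonneg _) ht three_ne_zero
  have h := (poch_multipliable a ht).hasProd
  rw [← ((Equiv.prodComm (Fin 3) ℕ).trans (Nat.divModEquiv 3).symm).hasProd_iff] at h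
  have h' := h.prod_fiberwise (g := fun i : Fin 3 ↦ poch (a * t ^ (i : ℕ)) (t ^ 3)) fun i ↦ by
    have := (poch_multipliable (a * t ^ (i : ℕ)) ht3).hasProd
    change HasProd _ (poch _ _) at this
    convert this using 2 with n
    simp [Nat.divModEquiv]
    ring
  rw [poch, ← h'.tprod_eq, tprod_fintype, Fin.prod_univ_three]
  simp

lemma poch_differentiable {t : ℂ} (ht : ‖t‖ < 1) : Differentiable ℂ fun a ↦ poch a t := by
  have key : HasProdLocallyUniformlyOn (fun (n : ℕ) (a : ℂ) ↦ 1 + -(a * t ^ n))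
      (fun a ↦ ∏' n : ℕ, (1 + -(a * t ^ n))) Set.univ := by
    apply hasProdLocallyUniformlyOn_of_forall_compact isOpen_univ
    intro K _ hcK
    obtain ⟨C, hC⟩ := hcK.isBounded.exists_norm_le
    refine ((summable_geometric_of_lt_one
      (norm_nonneg _) ht).mul_left C).hasProdUniformlyOn_nat_one_add
      hcK (.of_forall fun n x hx ↦ ?_) (fun _ ↦ by fun_prop)
    simpa using mul_le_mul_of_nonneg_right (hC x hx) (pow_nonneg (norm_nonneg t) n)
  have := key.differentiableOn
    (.of_forall fun _ ↦ by simpa [Finset.prod_fn] using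
      DifferentiableOn.finsetProd (fun _ _ ↦ by fun_prop)) isOpen_univ
  simpa [poch, sub_eq_add_neg, differentiableOn_univ] using this

lemma apply_zpow_mul {f : ℂ → ℂ} {t : ℂ} (ht0 : t ≠ 0) (hper : ∀ x ≠ 0, f (t * x) = f x) (n : ℤ) :
    ∀ x ≠ 0, f (t ^ n * x) = f x := by
  induction n with
  | zero => simp
  | succ n ih =>
    intro x hx
    rw [zpow_add_one₀ ht0, mul_right_comm, mul_comm _ t,
      hper _ (mul_ne_zero (zpow_ne_zero _ ht0) hx), ih x hx]
  | pred n ih =>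
    intro x hx
    rw [← ih x hx, ← hper _ (mul_ne_zero (zpow_ne_zero _ ht0) hx), zpow_sub_one₀ ht0]
    congr 1
    field_simp

lemma exists_zpow_mul_mem_annulus {t x : ℂ} (ht0 : t ≠ 0) (ht : ‖t‖ < 1) (hx : x ≠ 0) :
    ∃ n : ℤ, ‖t‖ < ‖t ^ n * x‖ ∧ ‖t ^ n * x‖ ≤ 1 := by
  have hnt : 0 < ‖t‖ := norm_pos_iff.2 ht0
  obtain ⟨n, hn1, hn2⟩ := exists_mem_Ioc_zpow (norm_pos_iff.2 hx) (one_lt_inv_iff₀.2 ⟨hnt, ht⟩)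
  refine ⟨n + 1, ?_, ?_⟩
  · rw [norm_mul, norm_zpow, zpow_add_one₀ hnt.ne']
    rw [inv_zpow, inv_lt_iff_one_lt_mul₀ (zpow_pos hnt _)] at hn1
    nlinarith
  · rw [norm_mul, norm_zpow]
    rw [inv_zpow] at hn2
    rwa [le_inv_comm₀ (norm_pos_iff.2 hx) (zpow_pos hnt _), ← one_div,
      le_div_iff₀ (norm_pos_iff.2 hx)] at hn2

/-- Liouville's theorem for functions on `ℂ \ {0}` that are invariant under `x ↦ t * x`. -/
lemma eq_of_mul_periodic {f : ℂ → ℂ} {t : ℂ} (ht0 : t ≠ 0) (ht : ‖t‖ < 1)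
    (hf : ∀ x ≠ 0, DifferentiableAt ℂ f x) (hper : ∀ x ≠ 0, f (t * x) = f x) {x y : ℂ}
    (hx : x ≠ 0) (hy : y ≠ 0) : f x = f y := by
  let S : Set ℂ := {x | ‖t‖ ≤ ‖x‖ ∧ ‖x‖ ≤ 1}
  have hS0 : ∀ x ∈ S, x ≠ 0 := fun x hx ↦ norm_pos_iff.1 ((norm_pos_iff.2 ht0).trans_le hx.1)
  have hScomp : IsCompact S := by
    refine (isCompact_closedBall (0 : ℂ) 1).of_isClosed_subset ?_ fun x hx ↦ by simpa using hx.2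
    exact (isClosed_le continuous_const continuous_norm).inter
      (isClosed_le continuous_norm continuous_const)
  obtain ⟨c, hcS, hc⟩ := hScomp.exists_isMaxOn ⟨1, by simp [S, ht.le]⟩
    (f := fun x ↦ ‖f x‖) fun x hx ↦ (hf x (hS0 x hx)).continuousAt.norm.continuousWithinAt
  have hconn : IsPreconnected ({0}ᶜ : Set ℂ) :=
    (isConnected_compl_singleton_of_one_lt_rank (by simp) 0).isPreconnected
  have hmax : IsMaxOn (norm ∘ f) ({0}ᶜ : Set ℂ) c := by
    intro x hx
    obtain ⟨n, h1, h2⟩ := exists_zpow_mul_mem_annulus ht0 ht hx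
    simpa [apply_zpow_mul ht0 hper n x hx] using hc (show t ^ n * x ∈ S from ⟨h1.le, h2⟩)
  have heq := Complex.eqOn_of_isPreconnected_of_isMaxOn_norm hconn isOpen_compl_singleton
    (fun x hx ↦ (hf x hx).differentiableWithinAt) (hS0 c hcS) hmax
  rw [heq hx, heq hy, Function.const, Function.const]

open Filter Topology in
/-- Liouville's theorem for functions on `ℂ \ {0}` that are invariant under `x ↦ t * x` and have
only removable singularities. -/
lemma exists_eventually_eq_of_mul_periodic {f : ℂ → ℂ} {t : ℂ} (ht0 : t ≠ 0) (ht : ‖t‖ < 1)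
    (hper : ∀ x ≠ 0, f (t * x) = f x)
    (hloc : ∀ x : ℂ, ‖t‖ < ‖x‖ → ‖x‖ ≤ 1 → ∃ g : ℂ → ℂ, AnalyticAt ℂ g x ∧ f =ᶠ[𝓝[≠] x] g) :
    ∃ c, ∀ x ≠ 0, ∀ᶠ z in 𝓝[≠] x, f z = c := by
  have hmul : ∀ a ≠ (0 : ℂ), ∀ x : ℂ, Tendsto (fun z ↦ a * z) (𝓝[≠] x) (𝓝[≠] (a * x)) := by
    intro a ha x
    refine tendsto_nhdsWithin_iff.2 ⟨Tendsto.mono_left (Continuous.tendsto (by fun_prop) x)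
      nhdsWithin_le_nhds, ?_⟩
    filter_upwards [self_mem_nhdsWithin] with z hz
    simpa [ha] using hz
  have hne : ∀ x ≠ (0 : ℂ), ∀ᶠ z in 𝓝[≠] x, z ≠ 0 := fun x hx ↦
    nhdsWithin_le_nhds (isOpen_ne.mem_nhds hx)
  have hloc' : ∀ x ≠ (0 : ℂ), ∃ g : ℂ → ℂ, AnalyticAt ℂ g x ∧ f =ᶠ[𝓝[≠] x] g := by
    intro x hx
    obtain ⟨n, h1, h2⟩ := exists_zpow_mul_mem_annulus ht0 ht hx
    obtain ⟨g, hg, hfg⟩ := hloc _ h1 h2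
    refine ⟨fun z ↦ g (t ^ n * z), hg.fun_comp (analyticAt_const.mul analyticAt_id), ?_⟩
    filter_upwards [hne x hx, (hmul _ (zpow_ne_zero n ht0) x).eventually hfg] with z hz hz'
    rw [← apply_zpow_mul ht0 hper n z hz, hz']
  let F : ℂ → ℂ := fun x ↦ limUnder (𝓝[≠] x) f
  have key : ∀ x ≠ (0 : ℂ), ∃ g : ℂ → ℂ, AnalyticAt ℂ g x ∧ f =ᶠ[𝓝[≠] x] g ∧ F =ᶠ[𝓝 x] g := by
    intro x hx
    obtain ⟨g, hg, hfg⟩ := hloc' x hx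
    refine ⟨g, hg, hfg, ?_⟩
    filter_upwards [hg.eventually_analyticAt, (eventually_nhdsWithin_iff.1 hfg).eventually_nhds]
      with y hy hy'
    have : f =ᶠ[𝓝[≠] y] g := by
      rcases eq_or_ne y x with rfl | hyx
      · exact hfg
      · filter_upwards [nhdsWithin_le_nhds hy', nhdsWithin_le_nhds (isOpen_ne.mem_nhds hyx)]
          with z hz hz' using hz hz'
    exact ((hy.continuousAt.tendsto.mono_left nhdsWithin_le_nhds).congr' this.symm).limUnder_eq
  have hlim : ∀ x ≠ (0 : ℂ), Tendsto f (𝓝[≠] x) (𝓝 (F x)) := by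
    intro x hx
    obtain ⟨g, hg, hfg, hF⟩ := key x hx
    rw [hF.eq_of_nhds]
    exact (hg.continuousAt.tendsto.mono_left nhdsWithin_le_nhds).congr' hfg.symm
  have hFper : ∀ x ≠ 0, F (t * x) = F x := by
    intro x hx
    refine tendsto_nhds_unique ((hlim _ (mul_ne_zero ht0 hx)).comp (hmul t ht0 x))
      ((hlim x hx).congr' ?_)
    filter_upwards [hne x hx] with z hz using (hper z hz).symm
  refine ⟨F 1, fun x hx ↦ ?_⟩
  obtain ⟨g, -, hfg, hF⟩ := key x hx
  filter_upwards [hfg, nhdsWithin_le_nhds hF, hne x hx] with z h1 h2 h3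
  rw [h1, ← h2]
  refine eq_of_mul_periodic ht0 ht (fun y hy ↦ ?_) hFper h3 one_ne_zero
  obtain ⟨g, hg, -, hF⟩ := key y hy
  exact (hg.congr hF.symm).differentiableAt

/-- The bilateral Appell-type series with double poles at the points `-t ^ m`. -/
noncomputable def doubleAppell (t x : ℂ) : ℂ :=
  ∑' m : ℤ, (-1) ^ m * t ^ (m ^ 2 + m) * x ^ (2 * m + 1) / (1 + x * t ^ m) ^ 2

lemma doubleAppell_mul {t x : ℂ} (ht0 : t ≠ 0) (hx : x ≠ 0) :
    doubleAppell t (t * x) = -(t * x ^ 2)⁻¹ * doubleAppell t x := by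
  rw [doubleAppell, doubleAppell, ← (Equiv.addRight (1 : ℤ)).tsum_eq (fun m : ℤ ↦
    (-1) ^ m * t ^ (m ^ 2 + m) * x ^ (2 * m + 1) / (1 + x * t ^ m) ^ 2), ← tsum_mul_left]
  refine tsum_congr fun m ↦ ?_
  have h1 : t * x * t ^ m = x * t ^ (m + 1) := by rw [zpow_add_one₀ ht0]; ring
  have h2 : t ^ ((m + 1) ^ 2 + (m + 1)) = t ^ (m ^ 2 + m) * t ^ (2 * m + 1) * t := by
    rw [← zpow_add₀ ht0, ← zpow_add_one₀ ht0]
    ring_nf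
  have h3 : x ^ (2 * (m + 1) + 1) = x ^ (2 * m + 1) * x ^ 2 := by
    rw [← zpow_natCast, ← zpow_add₀ hx]
    push_cast
    ring_nf
  simp only [Equiv.coe_addRight]
  rw [h1, h2, h3, mul_zpow, zpow_add_one₀ (by norm_num : (-1 : ℂ) ≠ 0), mul_div_assoc']
  congr 1
  field_simp

lemma doubleAppell_term_neg {t x : ℂ} (ht0 : t ≠ 0) (hx : x ≠ 0) (m : ℤ) :
    (-1) ^ (-m) * t ^ ((-m) ^ 2 + -m) * x ^ (2 * -m + 1) / (1 + x * t ^ (-m)) ^ 2 =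
      (-1) ^ m * t ^ (m ^ 2 + m) * x⁻¹ ^ (2 * m + 1) / (1 + x⁻¹ * t ^ m) ^ 2 := by
  have h1 : 1 + x * t ^ (-m) = (x * t ^ (-m)) * (1 + x⁻¹ * t ^ m) := by
    rw [zpow_neg]
    field_simp
    ring
  have h2 : t ^ ((-m) ^ 2 + -m) = t ^ (m ^ 2 + m) * (t ^ (-m)) ^ 2 := by
    rw [← zpow_natCast, ← zpow_mul, ← zpow_add₀ ht0]
    push_cast
    ring_nf
  have h3 : x ^ (2 * -m + 1) = x⁻¹ ^ (2 * m + 1) * x ^ 2 := by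
    rw [inv_zpow', ← zpow_natCast x 2, ← zpow_add₀ hx]
    push_cast
    ring_nf
  have h4 : ((-1 : ℂ)) ^ (-m) = (-1) ^ m := by rw [zpow_neg, ← inv_zpow]; norm_num
  have h5 : t ^ (-m) ≠ 0 := zpow_ne_zero _ ht0
  rw [h1, h2, h3, h4, mul_pow]
  generalize t ^ (-m) = w at h5
  rw [← mul_div_mul_left (_ * x⁻¹ ^ (2 * m + 1)) _ (pow_ne_zero 2 (mul_ne_zero hx h5))]
  congr 1
  ring

lemma doubleAppell_inv {t x : ℂ} (ht0 : t ≠ 0) (hx : x ≠ 0) :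
    doubleAppell t x⁻¹ = doubleAppell t x := by
  rw [doubleAppell, doubleAppell, ← (Equiv.neg ℤ).tsum_eq (fun m : ℤ ↦
    (-1) ^ m * t ^ (m ^ 2 + m) * x ^ (2 * m + 1) / (1 + x * t ^ m) ^ 2)]
  exact tsum_congr fun m ↦ (doubleAppell_term_neg ht0 hx m).symm

lemma norm_doubleAppell_term_le {t x : ℂ} {s : ℝ} (ht0 : t ≠ 0) (hts : ‖t‖ < s) (hs : s < 1)
    (hx : s < ‖x‖) (hx' : ‖x‖ < s⁻¹) {m : ℕ} (hm : m ≠ 0) :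
    ‖(-1) ^ (m : ℤ) * t ^ ((m : ℤ) ^ 2 + m) * x ^ (2 * (m : ℤ) + 1) / (1 + x * t ^ (m : ℤ)) ^ 2‖ ≤
      s⁻¹ ^ 2 * (1 - ‖t‖ * s⁻¹)⁻¹ ^ 2 * s ^ m := by
  have hs0 : 0 < s := (norm_nonneg t).trans_lt hts
  have hx0 : 0 < ‖x‖ := hs0.trans hx
  have hr : ‖t‖ * s⁻¹ < 1 := by rwa [← div_eq_mul_inv, div_lt_one hs0]
  have hden : 1 - ‖t‖ * s⁻¹ ≤ ‖1 + x * t ^ m‖ := by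
    have h1 : ‖x * t ^ m‖ ≤ ‖t‖ * s⁻¹ := by
      rw [norm_mul, norm_pow, mul_comm]
      exact mul_le_mul (pow_le_of_le_one (norm_nonneg _) (hts.trans hs).le hm) hx'.le hx0.le
        (norm_nonneg _)
    have h2 := norm_sub_le_norm_add (1 : ℂ) (x * t ^ m)
    rw [norm_one] at h2
    linarith
  have e : (-1 : ℂ) ^ (m : ℤ) * t ^ ((m : ℤ) ^ 2 + m) * x ^ (2 * (m : ℤ) + 1) /
      (1 + x * t ^ (m : ℤ)) ^ 2 =
      (-1) ^ m * t ^ (m ^ 2 + m) * x ^ (2 * m + 1) / (1 + x * t ^ m) ^ 2 := by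
    norm_cast
  have hnum : ‖t‖ ^ (m ^ 2 + m) * ‖x‖ ^ (2 * m + 1) ≤ s⁻¹ ^ 2 * s ^ m := by
    calc ‖t‖ ^ (m ^ 2 + m) * ‖x‖ ^ (2 * m + 1) ≤ s ^ (m ^ 2 + m) * s⁻¹ ^ (2 * m + 1) := by gcongr
      _ = s⁻¹ ^ 2 * (s ^ (m ^ 2 + m + 2) * s⁻¹ ^ (2 * m + 1)) := by
        rw [pow_add s (m ^ 2 + m) 2]; field_simp
      _ ≤ s⁻¹ ^ 2 * (s ^ (m + (2 * m + 1)) * s⁻¹ ^ (2 * m + 1)) := by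
        have : m + (2 * m + 1) ≤ m ^ 2 + m + 2 := by
          zify
          nlinarith [sq_nonneg ((m : ℤ) - 1)]
        have := pow_le_pow_of_le_one hs0.le hs.le this
        gcongr
      _ = s⁻¹ ^ 2 * s ^ m := by rw [pow_add s m, mul_assoc, ← mul_pow, mul_inv_cancel₀ hs0.ne']; simp
  rw [e, norm_div, norm_mul, norm_mul, norm_pow, norm_pow, norm_pow, norm_pow, norm_neg, norm_one,
    one_pow, one_mul, div_eq_mul_inv, ← inv_pow]
  have hd : 0 < 1 - ‖t‖ * s⁻¹ := sub_pos.2 hr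
  have hinv : ‖1 + x * t ^ m‖⁻¹ ^ 2 ≤ (1 - ‖t‖ * s⁻¹)⁻¹ ^ 2 := by gcongr
  exact (mul_le_mul hnum hinv (by positivity) (by positivity)).trans_eq (by ring)

lemma norm_doubleAppell_term_le_int {t x : ℂ} {s : ℝ} (ht0 : t ≠ 0) (hts : ‖t‖ < s) (hs : s < 1)
    (hx : s < ‖x‖) (hx' : ‖x‖ < s⁻¹) {m : ℤ} (hm : m ≠ 0) :
    ‖(-1) ^ m * t ^ (m ^ 2 + m) * x ^ (2 * m + 1) / (1 + x * t ^ m) ^ 2‖ ≤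
      s⁻¹ ^ 2 * (1 - ‖t‖ * s⁻¹)⁻¹ ^ 2 * s ^ m.natAbs := by
  have hs0 : 0 < s := (norm_nonneg t).trans_lt hts
  obtain ⟨n, rfl | rfl⟩ := m.eq_nat_or_neg
  · exact norm_doubleAppell_term_le ht0 hts hs hx hx' (by simpa using hm)
  · have := norm_doubleAppell_term_le (x := x⁻¹) ht0 hts hs
      (by rw [norm_inv]; exact (lt_inv_comm₀ (hs0.trans hx) hs0).1 hx')
      (by rw [norm_inv]; exact inv_strictAnti₀ hs0 hx) (m := n) (by simpa using hm)
    rw [doubleAppell_term_neg ht0 (norm_pos_iff.1 (hs0.trans hx))]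
    simpa using this

lemma summable_mul_pow_natAbs (C : ℝ) {s : ℝ} (hs0 : 0 < s) (hs : s < 1) :
    Summable fun m : ℤ ↦ C * s ^ m.natAbs := by
  refine Summable.mul_left _ (Summable.of_nat_of_neg ?_ ?_) <;>
    simpa using summable_geometric_of_lt_one hs0.le hs

lemma summable_doubleAppell {t x : ℂ} {s : ℝ} (ht0 : t ≠ 0) (hts : ‖t‖ < s) (hs : s < 1)
    (hx : s < ‖x‖) (hx' : ‖x‖ < s⁻¹) :
    Summable fun m : ℤ ↦ (-1) ^ m * t ^ (m ^ 2 + m) * x ^ (2 * m + 1) / (1 + x * t ^ m) ^ 2 := by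
  refine .of_norm_bounded_eventually
    (summable_mul_pow_natAbs (s⁻¹ ^ 2 * (1 - ‖t‖ * s⁻¹)⁻¹ ^ 2) ((norm_nonneg t).trans_lt hts) hs) ?_
  filter_upwards [(Set.finite_singleton (0 : ℤ)).compl_mem_cofinite] with m hm
  exact norm_doubleAppell_term_le_int ht0 hts hs hx hx' hm

open Filter Topology in
lemma exists_analyticAt_doubleAppell {t x₀ : ℂ} (ht0 : t ≠ 0) (ht : ‖t‖ < 1) (h1 : ‖t‖ < ‖x₀‖)
    (h2 : ‖x₀‖ ≤ 1) :
    ∃ g : ℂ → ℂ, AnalyticAt ℂ g x₀ ∧ ∀ᶠ x in 𝓝 x₀, doubleAppell t x = x / (1 + x) ^ 2 + g x := by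
  obtain ⟨s, hts, hsx⟩ := exists_between h1
  have hs1 : s < 1 := hsx.trans_le h2
  have hs0 : 0 < s := (norm_nonneg t).trans_lt hts
  let U : Set ℂ := {x | s < ‖x‖ ∧ ‖x‖ < s⁻¹}
  have hU : IsOpen U :=
    (isOpen_lt continuous_const continuous_norm).inter (isOpen_lt continuous_norm continuous_const)
  have hx₀ : U ∈ 𝓝 x₀ := hU.mem_nhds ⟨hsx, h2.trans_lt ((one_lt_inv₀ hs0).2 hs1)⟩
  have hU0 : ∀ x ∈ U, x ≠ 0 := fun x hx ↦ norm_pos_iff.1 (hs0.trans hx.1)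
  let T : ℤ → ℂ → ℂ := fun m x ↦
    (-1) ^ m * t ^ (m ^ 2 + m) * x ^ (2 * m + 1) / (1 + x * t ^ m) ^ 2
  let u : ℤ → ℝ := fun m ↦ s⁻¹ ^ 2 * (1 - ‖t‖ * s⁻¹)⁻¹ ^ 2 * s ^ m.natAbs
  have hu : Summable u := summable_mul_pow_natAbs _ hs0 hs1
  have hT' : ∀ m, ∀ x ∈ U, ‖if m = 0 then 0 else T m x‖ ≤ u m := by
    intro m x hx
    split_ifs with hm
    · have : 0 ≤ u m := by positivity
      simpa using this
    · exact norm_doubleAppell_term_le_int ht0 hts hs1 hx.1 hx.2 hm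
  have hne : ∀ m : ℤ, m ≠ 0 → ∀ x ∈ U, 1 + x * t ^ m ≠ 0 := by
    intro m hm x hx h
    have h3 : ‖x‖ * ‖t‖ ^ m = 1 := by
      rw [← norm_zpow, ← norm_mul, eq_neg_of_add_eq_zero_right h, norm_neg, norm_one]
    have htp : 0 < ‖t‖ := norm_pos_iff.2 ht0
    rcases lt_or_gt_of_ne hm with hm | hm
    · have : ‖t‖ ^ (-1 : ℤ) ≤ ‖t‖ ^ m := zpow_le_zpow_right_of_le_one₀ htp ht.le (by omega)
      rw [zpow_neg_one] at this
      have h4 : 1 < ‖x‖ * ‖t‖⁻¹ := by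
        rw [← div_eq_mul_inv, one_lt_div htp]; exact hts.trans hx.1
      nlinarith [norm_nonneg x]
    · have : ‖t‖ ^ m ≤ ‖t‖ ^ (1 : ℤ) := zpow_le_zpow_right_of_le_one₀ htp ht.le (by omega)
      rw [zpow_one] at this
      have h4 : ‖x‖ * ‖t‖ < 1 := by
        calc ‖x‖ * ‖t‖ < s⁻¹ * s := by
              exact mul_lt_mul'' hx.2 hts (norm_nonneg _) (norm_nonneg _)
          _ = 1 := inv_mul_cancel₀ hs0.ne'
      nlinarith [norm_nonneg x]
  refine ⟨fun x ↦ ∑' m : ℤ, if m = 0 then 0 else T m x, ?_, ?_⟩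
  · refine (Complex.differentiableOn_tsum_of_summable_norm hu (fun m ↦ ?_) hU hT').analyticAt hx₀
    by_cases hm : m = 0
    · simp [hm]
    · simp only [hm, if_false]
      intro x hx
      refine DifferentiableAt.differentiableWithinAt ?_
      have hxm := hne m hm x hx
      refine DifferentiableAt.div ?_ (by fun_prop) (pow_ne_zero _ hxm)
      exact (differentiableAt_zpow.2 (Or.inl (hU0 x hx))).const_mul _
  · filter_upwards [hx₀] with x hx
    rw [doubleAppell, (summable_doubleAppell ht0 hts hs1 hx.1 hx.2).tsum_eq_add_tsum_ite 0]
    simp [T]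

/-- The theta product `(x; t)_∞ (t / x; t)_∞`. -/
noncomputable def theta (t x : ℂ) : ℂ := poch x t * poch (t / x) t

/-- The theta product `(x² t; t²)_∞ (t / x²; t²)_∞`. -/
noncomputable def thetaSq (t x : ℂ) : ℂ := poch (x ^ 2 * t) (t ^ 2) * poch (t / x ^ 2) (t ^ 2)

lemma norm_sq_lt_one {t : ℂ} (ht : ‖t‖ < 1) : ‖t ^ 2‖ < 1 := by
  rw [norm_pow]
  exact pow_lt_one₀ (norm_nonneg _) ht two_ne_zero

lemma theta_eq (x : ℂ) {t : ℂ} (ht : ‖t‖ < 1) :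
    theta t x = (1 - x) * (poch (x * t) t * poch (t / x) t) := by
  rw [theta, poch_succ x ht, mul_assoc]

lemma thetaSq_eq (x : ℂ) {t : ℂ} (ht : ‖t‖ < 1) :
    thetaSq t x =
      (1 - t / x ^ 2) * (poch (x ^ 2 * t) (t ^ 2) * poch (t / x ^ 2 * t ^ 2) (t ^ 2)) := by
  rw [thetaSq, poch_succ (t / x ^ 2) (norm_sq_lt_one ht)]
  ring

lemma theta_mul {t x : ℂ} (ht0 : t ≠ 0) (ht : ‖t‖ < 1) (hx : x ≠ 0) :
    theta t (t * x) = -x⁻¹ * theta t x := by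
  have h : t / (t * x) = x⁻¹ := by field_simp
  rw [theta_eq x ht, theta, h, poch_succ x⁻¹ ht, mul_comm t x, inv_mul_eq_div]
  field_simp
  ring

lemma thetaSq_mul {t x : ℂ} (ht0 : t ≠ 0) (ht : ‖t‖ < 1) (hx : x ≠ 0) :
    thetaSq t (t * x) = -(t * x ^ 2)⁻¹ * thetaSq t x := by
  have ht2 := norm_sq_lt_one ht
  have h1 : t / (t * x) ^ 2 = (x ^ 2 * t)⁻¹ := by field_simp
  have h2 : (x ^ 2 * t)⁻¹ * t ^ 2 = t / x ^ 2 := by field_simp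
  have h3 : (t * x) ^ 2 * t = x ^ 2 * t * t ^ 2 := by ring
  rw [thetaSq, thetaSq, h1, h3, poch_succ (x ^ 2 * t)⁻¹ ht2, h2, poch_succ (x ^ 2 * t) ht2]
  field_simp
  ring

lemma thetaSq_inv (t x : ℂ) : thetaSq t x⁻¹ = thetaSq t x := by
  rw [thetaSq, thetaSq, mul_comm]
  congr 2
  · rw [inv_pow, div_inv_eq_mul, mul_comm]
  · rw [inv_pow, div_eq_mul_inv, mul_comm]

lemma thetaSq_neg (t x : ℂ) : thetaSq t (-x) = thetaSq t x := by
  simp [thetaSq]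

/-- The alternating combination of `doubleAppell` and `thetaSq` that vanishes at `x = 1`. -/
noncomputable def appellDiff (t x : ℂ) : ℂ :=
  doubleAppell t x * thetaSq t 1 - doubleAppell t 1 * thetaSq t x

lemma appellDiff_mul {t x : ℂ} (ht0 : t ≠ 0) (ht : ‖t‖ < 1) (hx : x ≠ 0) :
    appellDiff t (t * x) = -(t * x ^ 2)⁻¹ * appellDiff t x := by
  rw [appellDiff, appellDiff, doubleAppell_mul ht0 hx, thetaSq_mul ht0 ht hx]
  ring

lemma appellDiff_inv {t x : ℂ} (ht0 : t ≠ 0) (hx : x ≠ 0) :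
    appellDiff t x⁻¹ = appellDiff t x := by
  rw [appellDiff, appellDiff, doubleAppell_inv ht0 hx, thetaSq_inv]

lemma appellDiff_eq_zero {t x : ℂ} (ht0 : t ≠ 0) (ht : ‖t‖ < 1) (hx : x ^ 2 = t) :
    appellDiff t x = 0 := by
  have hx0 : x ≠ 0 := by rintro rfl; simp [eq_comm, ht0] at hx
  have h := appellDiff_mul ht0 ht (inv_ne_zero hx0)
  have h1 : t * x⁻¹ = x := by rw [← hx]; field_simp
  have h2 : t * x⁻¹ ^ 2 = 1 := by rw [← hx]; field_simp
  rw [h1, h2, appellDiff_inv ht0 hx0] at h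
  linear_combination h / 2

lemma analyticAt_poch {f : ℂ → ℂ} {t x : ℂ} (ht : ‖t‖ < 1) (hf : AnalyticAt ℂ f x) :
    AnalyticAt ℂ (fun y ↦ poch (f y) t) x :=
  ((poch_differentiable ht).analyticAt (f x)).fun_comp hf

lemma analyticAt_thetaSq {t x : ℂ} (ht : ‖t‖ < 1) (hx : x ≠ 0) : AnalyticAt ℂ (thetaSq t) x := by
  have ht2 := norm_sq_lt_one ht
  have hx2 := pow_ne_zero 2 hx
  exact (analyticAt_poch ht2 (by fun_prop)).mul
    (analyticAt_poch ht2 (by fun_prop (disch := assumption)))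

/-- The zero-free part of `theta t (-x) ^ 2 / (theta t x ^ 2 * thetaSq t x)`. -/
noncomputable def thetaUnit (t x : ℂ) : ℂ :=
  (poch (-x * t) t * poch (t / -x) t) ^ 2 / ((poch (x * t) t * poch (t / x) t) ^ 2 *
    (poch (x ^ 2 * t) (t ^ 2) * poch (t / x ^ 2 * t ^ 2) (t ^ 2)))

lemma poch_mul_poch_div_ne_zero {t x : ℂ} (ht : ‖t‖ < 1) (h1 : ‖t‖ < ‖x‖) (h2 : ‖x‖ ≤ 1) :
    poch (x * t) t * poch (t / x) t ≠ 0 := by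
  refine mul_ne_zero (poch_ne_zero_of_norm_lt_one ht ?_) (poch_ne_zero_of_norm_lt_one ht ?_)
  · rw [norm_mul]
    nlinarith [norm_nonneg t, norm_nonneg x]
  · rwa [norm_div, div_lt_one ((norm_nonneg t).trans_lt h1)]

lemma poch_sq_mul_poch_div_sq_ne_zero {t x : ℂ} (ht : ‖t‖ < 1) (h1 : ‖t‖ < ‖x‖) (h2 : ‖x‖ ≤ 1) :
    poch (x ^ 2 * t) (t ^ 2) * poch (t / x ^ 2 * t ^ 2) (t ^ 2) ≠ 0 := by
  have ht2 := norm_sq_lt_one ht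
  have hx0 : 0 < ‖x‖ := (norm_nonneg t).trans_lt h1
  refine mul_ne_zero (poch_ne_zero_of_norm_lt_one ht2 ?_) (poch_ne_zero_of_norm_lt_one ht2 ?_)
  · rw [norm_mul, norm_pow]
    exact (mul_le_of_le_one_left (norm_nonneg _) (pow_le_one₀ (norm_nonneg _) h2)).trans_lt ht
  · rw [div_mul_eq_mul_div, norm_div, norm_mul, norm_pow, norm_pow, div_lt_one (by positivity)]
    calc ‖t‖ * ‖t‖ ^ 2 ≤ 1 * ‖t‖ ^ 2 := by gcongr
      _ < ‖x‖ ^ 2 := by rw [one_mul]; gcongr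

lemma analyticAt_thetaUnit {t x : ℂ} (ht : ‖t‖ < 1) (h1 : ‖t‖ < ‖x‖) (h2 : ‖x‖ ≤ 1) :
    AnalyticAt ℂ (thetaUnit t) x := by
  have ht2 := norm_sq_lt_one ht
  have hx : x ≠ 0 := norm_pos_iff.1 ((norm_nonneg t).trans_lt h1)
  have hx' : -x ≠ 0 := neg_ne_zero.2 hx
  have hx2 := pow_ne_zero 2 hx
  refine AnalyticAt.div (((analyticAt_poch ht ?_).mul (analyticAt_poch ht ?_)).pow 2)
    ((((analyticAt_poch ht ?_).mul (analyticAt_poch ht ?_)).pow 2).mul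
      ((analyticAt_poch ht2 ?_).mul (analyticAt_poch ht2 ?_)))
    (mul_ne_zero (pow_ne_zero 2 (poch_mul_poch_div_ne_zero ht h1 h2))
      (poch_sq_mul_poch_div_sq_ne_zero ht h1 h2))
  all_goals fun_prop (disch := assumption)

/-- The quotient of `appellDiff` by its expected product form. -/
noncomputable def appellQuot (t x : ℂ) : ℂ :=
  appellDiff t x * theta t (-x) ^ 2 / (theta t x ^ 2 * thetaSq t x)

lemma appellQuot_mul {t : ℂ} (ht0 : t ≠ 0) (ht : ‖t‖ < 1) (x : ℂ) (hx : x ≠ 0) :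
    appellQuot t (t * x) = appellQuot t x := by
  have hc : -(t * x ^ 2)⁻¹ * (x⁻¹ ^ 2) ≠ 0 := by simp [ht0, hx]
  rw [appellQuot, appellQuot, ← mul_neg, appellDiff_mul ht0 ht hx, theta_mul ht0 ht hx,
    theta_mul ht0 ht (neg_ne_zero.2 hx), thetaSq_mul ht0 ht hx,
    ← mul_div_mul_left (appellDiff t x * _) _ hc]
  congr 1
  · rw [inv_neg]
    ring
  · ring

lemma appellQuot_eq (x : ℂ) {t : ℂ} (ht : ‖t‖ < 1) :
    appellQuot t x = (1 + x) ^ 2 * appellDiff t x * thetaUnit t x /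
      ((1 - x) ^ 2 * (1 - t / x ^ 2)) := by
  rw [appellQuot, theta_eq x ht, theta_eq (-x) ht, thetaSq_eq x ht, thetaUnit, mul_div_assoc',
    div_div]
  congr 1 <;> ring

open Filter Topology in
lemma exists_analyticAt_appellDiff {t x₀ : ℂ} (ht0 : t ≠ 0) (ht : ‖t‖ < 1) (h1 : ‖t‖ < ‖x₀‖)
    (h2 : ‖x₀‖ ≤ 1) :
    ∃ M : ℂ → ℂ, AnalyticAt ℂ M x₀ ∧
      (∀ᶠ x in 𝓝 x₀, x ≠ -1 → M x = (1 + x) ^ 2 * appellDiff t x) ∧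
      (x₀ = -1 → M x₀ = -thetaSq t 1) := by
  have hx₀ : x₀ ≠ 0 := norm_pos_iff.1 ((norm_nonneg t).trans_lt h1)
  obtain ⟨g, hg, hgx⟩ := exists_analyticAt_doubleAppell ht0 ht h1 h2
  have hB := analyticAt_thetaSq ht hx₀
  refine ⟨fun x ↦ (x + g x * (1 + x) ^ 2) * thetaSq t 1 -
    doubleAppell t 1 * thetaSq t x * (1 + x) ^ 2, by fun_prop, ?_, ?_⟩
  · filter_upwards [hgx] with x hx hx1
    have : 1 + x ≠ 0 := fun h ↦ hx1 (eq_neg_of_add_eq_zero_right h)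
    rw [appellDiff, hx]
    field_simp
  · rintro rfl
    simp

open Filter Topology in
lemma deriv_eq_zero_of_inv_symm {M : ℂ → ℂ} (hM : DifferentiableAt ℂ M 1) (h0 : M 1 = 0)
    (hinv : ∀ᶠ x in 𝓝 (1 : ℂ), x ^ 2 * M x⁻¹ = M x) : deriv M 1 = 0 := by
  have hd := hM.hasDerivAt
  have h1 : HasDerivAt (fun x : ℂ ↦ M x⁻¹) (deriv M 1 * -(1 ^ 2)⁻¹) 1 := by
    refine HasDerivAt.comp (h₂ := M) 1 ?_ (hasDerivAt_inv one_ne_zero)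
    simpa using hd
  have h2 := (((hasDerivAt_pow 2 (1 : ℂ)).mul h1).congr_of_eventuallyEq
    (f₁ := M) (hinv.mono fun x hx ↦ hx.symm)).unique hd
  simp [h0] at h2
  linear_combination (-1 / 2 : ℂ) * h2

lemma analyticAt_dslope {f : ℂ → ℂ} {x : ℂ} (hf : AnalyticAt ℂ f x) :
    AnalyticAt ℂ (dslope f x) x :=
  let ⟨_, hp⟩ := hf
  ⟨_, hp.has_fpower_series_dslope_fslope⟩

lemma eq_sub_mul_dslope {f : ℂ → ℂ} {x : ℂ} (h : f x = 0) (y : ℂ) :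
    f y = (y - x) * dslope f x y := by
  have := sub_smul_dslope f x y
  rw [h, sub_zero, smul_eq_mul] at this
  exact this.symm

open Filter Topology in
lemma exists_analyticAt_appellQuot {t x₀ : ℂ} (ht0 : t ≠ 0) (ht : ‖t‖ < 1) (h1 : ‖t‖ < ‖x₀‖)
    (h2 : ‖x₀‖ ≤ 1) : ∃ g : ℂ → ℂ, AnalyticAt ℂ g x₀ ∧ appellQuot t =ᶠ[𝓝[≠] x₀] g := by
  have hx₀ : x₀ ≠ 0 := norm_pos_iff.1 ((norm_nonneg t).trans_lt h1)
  obtain ⟨M, hM, hMx, -⟩ := exists_analyticAt_appellDiff ht0 ht h1 h2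
  have hR := analyticAt_thetaUnit ht h1 h2
  have hne : ∀ᶠ x in 𝓝[≠] x₀, x ≠ -1 := by
    rcases eq_or_ne x₀ (-1) with rfl | h
    · exact self_mem_nhdsWithin
    · exact nhdsWithin_le_nhds (isOpen_ne.mem_nhds h)
  have hK : ∀ᶠ x in 𝓝[≠] x₀, x ≠ x₀ ∧ x ≠ 0 ∧
      appellQuot t x = M x * thetaUnit t x / ((1 - x) ^ 2 * (1 - t / x ^ 2)) := by
    filter_upwards [hne, nhdsWithin_le_nhds hMx, self_mem_nhdsWithin,
      nhdsWithin_le_nhds (isOpen_ne.mem_nhds hx₀)] with x h h' h'' h'''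
    exact ⟨h'', h''', by rw [appellQuot_eq x ht, h' h]⟩
  have ht1 : t ≠ 1 := by rintro rfl; simp at ht
  rcases eq_or_ne x₀ 1 with rfl | hx1
  · have hM1 : M 1 = 0 := by
      rw [hMx.self_of_nhds (by norm_num)]
      simp [appellDiff]
    have hinv : ∀ᶠ x in 𝓝 (1 : ℂ), x ^ 2 * M x⁻¹ = M x := by
      have h3 : Tendsto (fun x : ℂ ↦ x⁻¹) (𝓝 1) (𝓝 1) := by
        simpa using (continuousAt_inv₀ (one_ne_zero : (1 : ℂ) ≠ 0)).tendsto
      filter_upwards [hMx, h3.eventually hMx, isOpen_ne.mem_nhds (one_ne_zero : (1 : ℂ) ≠ 0),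
        isOpen_ne.mem_nhds (by norm_num : (1 : ℂ) ≠ -1)] with x h4 h5 h6 h7
      have h8 : x⁻¹ ≠ -1 := fun h ↦ h7 (by rw [← inv_inv x, h]; norm_num)
      rw [h4 h7, h5 h8, appellDiff_inv ht0 h6]
      field_simp
      ring
    have hM2 : dslope M 1 1 = 0 := by
      rw [dslope_same]
      exact deriv_eq_zero_of_inv_symm hM.differentiableAt hM1 hinv
    refine ⟨fun x ↦ dslope (dslope M 1) 1 x * thetaUnit t x / (1 - t / x ^ 2), ?_, ?_⟩
    · have := analyticAt_dslope (analyticAt_dslope hM)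
      refine (this.mul hR).div (by fun_prop (disch := simp)) ?_
      simpa [sub_eq_zero] using ht1.symm
    · filter_upwards [hK] with x ⟨h3, h4, h5⟩
      have h6 : 1 - x ≠ 0 := sub_ne_zero.2 h3.symm
      rw [h5, eq_sub_mul_dslope hM1 x, eq_sub_mul_dslope hM2 x,
        ← mul_div_mul_left (dslope (dslope M 1) 1 x * thetaUnit t x) _ (pow_ne_zero 2 h6)]
      congr 1
      ring
  rcases eq_or_ne (x₀ ^ 2) t with hxt | hxt
  · have hx1' : x₀ ≠ -1 := by
      rintro rfl
      exact ht1 (by rw [← hxt]; norm_num)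
    have hM1 : M x₀ = 0 := by
      rw [hMx.self_of_nhds hx1', appellDiff_eq_zero ht0 ht hxt, mul_zero]
    refine ⟨fun x ↦ dslope M x₀ x * thetaUnit t x * x ^ 2 / ((1 - x) ^ 2 * (x + x₀)), ?_, ?_⟩
    · have := analyticAt_dslope hM
      refine ((this.mul hR).mul (by fun_prop)).div (by fun_prop) ?_
      refine mul_ne_zero (pow_ne_zero 2 (sub_ne_zero.2 hx1.symm)) ?_
      rw [← two_mul]
      exact mul_ne_zero two_ne_zero hx₀
    · filter_upwards [hK] with x ⟨h3, h4, h5⟩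
      have h6 : (x - x₀) / x ^ 2 ≠ 0 := div_ne_zero (sub_ne_zero.2 h3) (pow_ne_zero 2 h4)
      rw [h5, eq_sub_mul_dslope hM1 x, ← mul_div_mul_left (_ * x ^ 2) _ h6, ← hxt]
      congr 1
      · field_simp
      · field_simp
        ring
  · refine ⟨fun x ↦ M x * thetaUnit t x / ((1 - x) ^ 2 * (1 - t / x ^ 2)), ?_,
      hK.mono fun x hx ↦ hx.2.2⟩
    refine (hM.mul hR).div (by fun_prop (disch := simpa using hx₀)) ?_
    refine mul_ne_zero (pow_ne_zero 2 (sub_ne_zero.2 hx1.symm)) (sub_ne_zero.2 ?_)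
    rw [ne_comm, Ne, div_eq_one_iff_eq (pow_ne_zero 2 hx₀)]
    exact hxt.symm

open Filter Topology in
/-- Away from the zeros of the denominator, `appellQuot` agrees with its constant value. -/
lemma eq_of_eventually_appellQuot_eq {t c x₀ : ℂ} (ht0 : t ≠ 0) (ht : ‖t‖ < 1)
    (h1 : ‖t‖ < ‖x₀‖) (h2 : ‖x₀‖ ≤ 1) (hx1 : x₀ ≠ 1) (hxt : x₀ ^ 2 ≠ t)
    (hc : ∀ᶠ x in 𝓝[≠] x₀, appellQuot t x = c) :
    (x₀ ≠ -1 → appellQuot t x₀ = c) ∧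
      (x₀ = -1 → -thetaSq t 1 * thetaUnit t (-1) / (4 * (1 - t)) = c) := by
  have hx₀ : x₀ ≠ 0 := norm_pos_iff.1 ((norm_nonneg t).trans_lt h1)
  obtain ⟨M, hM, hMx, hM1⟩ := exists_analyticAt_appellDiff ht0 ht h1 h2
  have hne : ∀ᶠ x in 𝓝[≠] x₀, x ≠ -1 := by
    rcases eq_or_ne x₀ (-1) with rfl | h
    · exact self_mem_nhdsWithin
    · exact nhdsWithin_le_nhds (isOpen_ne.mem_nhds h)
  let G : ℂ → ℂ := fun x ↦ M x * thetaUnit t x / ((1 - x) ^ 2 * (1 - t / x ^ 2))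
  have hG : AnalyticAt ℂ G x₀ := by
    refine (hM.mul (analyticAt_thetaUnit ht h1 h2)).div
      (by fun_prop (disch := simpa using hx₀)) ?_
    refine mul_ne_zero (pow_ne_zero 2 (sub_ne_zero.2 hx1.symm)) (sub_ne_zero.2 ?_)
    rw [ne_comm, Ne, div_eq_one_iff_eq (pow_ne_zero 2 hx₀)]
    exact hxt.symm
  have hGc : G x₀ = c := by
    refine tendsto_nhds_unique (l := 𝓝[≠] x₀) (hG.continuousAt.tendsto.mono_left nhdsWithin_le_nhds)
      (tendsto_const_nhds.congr' ?_)
    filter_upwards [hc, hne, nhdsWithin_le_nhds hMx] with x h3 h4 h5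
    rw [← h3, appellQuot_eq x ht, ← h5 h4]
  constructor
  · intro h
    rw [← hGc, appellQuot_eq x₀ ht, ← hMx.self_of_nhds h]
  · rintro rfl
    rw [← hGc]
    simp only [G, hM1 rfl]
    congr 1
    norm_num

/-- The product form of `appellDiff`. -/
lemma appellDiff_mul_theta_sq {t x : ℂ} (ht0 : t ≠ 0) (ht : ‖t‖ < 1) (h1 : ‖t‖ < ‖x‖)
    (h2 : ‖x‖ ≤ 1) (hx1 : x ≠ 1) (hx1' : x ≠ -1) (hxt : x ^ 2 ≠ t) :
    appellDiff t x * theta t (-x) ^ 2 * theta t (-1) ^ 2 =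
      -poch t t ^ 4 * theta t x ^ 2 * thetaSq t x := by
  obtain ⟨c, hc⟩ := exists_eventually_eq_of_mul_periodic ht0 ht (appellQuot_mul ht0 ht)
    fun y ↦ exists_analyticAt_appellQuot ht0 ht
  have hx0 : x ≠ 0 := norm_pos_iff.1 ((norm_nonneg t).trans_lt h1)
  have ht1 : t ≠ 1 := by rintro rfl; simp at ht
  have hxc := (eq_of_eventually_appellQuot_eq ht0 ht h1 h2 hx1 hxt (hc x hx0)).1 hx1'
  have hcc := (eq_of_eventually_appellQuot_eq ht0 ht (by simpa using ht) (by simp)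
    (by norm_num) (by simpa using ht1.symm) (hc (-1) (by simp))).2 rfl
  have hθ : theta t x ≠ 0 := by
    rw [theta_eq x ht]
    exact mul_ne_zero (sub_ne_zero.2 hx1.symm) (poch_mul_poch_div_ne_zero ht h1 h2)
  have hθ' : theta t (-1) ≠ 0 := by
    rw [theta_eq _ ht]
    exact mul_ne_zero (by norm_num) (poch_mul_poch_div_ne_zero ht (by simpa using ht) (by simp))
  have hS : thetaSq t x ≠ 0 := by
    rw [thetaSq_eq x ht]
    refine mul_ne_zero (sub_ne_zero.2 ?_) (poch_sq_mul_poch_div_sq_ne_zero ht h1 h2)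
    rw [ne_comm, Ne, div_eq_one_iff_eq (pow_ne_zero 2 hx0)]
    exact hxt.symm
  have hS1 := poch_sq_mul_poch_div_sq_ne_zero (x := -1) ht (by simpa using ht) (by simp)
  have hcval : c * theta t (-1) ^ 2 = -poch t t ^ 4 := by
    have e1 := thetaSq_eq (-1) ht
    have e2 := theta_eq (-1) ht
    rw [thetaSq_neg] at e1
    have hp := poch_mul_poch_div_ne_zero (x := -1) ht (by simpa using ht) (by simp)
    have h1t : 1 - t ≠ 0 := sub_ne_zero.2 ht1.symm
    have e3 : thetaUnit t (-1) = (poch t t * poch t t) ^ 2 / ((poch (-1 * t) t * poch (t / -1) t) ^ 2 *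
        (poch ((-1) ^ 2 * t) (t ^ 2) * poch (t / (-1) ^ 2 * t ^ 2) (t ^ 2))) := by
      simp [thetaUnit]
    rw [← hcc, e1, e2, e3]
    generalize poch ((-1) ^ 2 * t) (t ^ 2) * poch (t / (-1) ^ 2 * t ^ 2) (t ^ 2) = b at hS1 ⊢
    generalize poch (-1 * t) t * poch (t / -1) t = a at hp ⊢
    norm_num
    field_simp
    norm_num
  rw [appellQuot, div_eq_iff (mul_ne_zero (pow_ne_zero 2 hθ) hS)] at hxc
  rw [hxc, ← hcval]
  ring

lemma doubleAppell_pow_eq (q : ℂ) :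
    doubleAppell ((q ^ 3) ^ 3) 1 =
      ∑' n : ℤ, (-1 : ℂ) ^ n * q ^ (9 * n ^ 2 + 9 * n) / (1 + q ^ (9 * n)) ^ 2 := by
  refine tsum_congr fun n ↦ ?_
  rw [← pow_mul, ← zpow_natCast q, ← zpow_mul, ← zpow_mul, one_zpow, mul_one, one_mul]
  push_cast
  ring_nf

/-- Dissection of the series modulo `3`. -/
lemma tsum_eq_doubleAppell {q : ℂ} (hq0 : q ≠ 0) (hq : ‖q‖ < 1) :
    (∑' n : ℤ, (-1 : ℂ) ^ n * q ^ (n ^ 2 + 3 * n) / (1 + q ^ (3 * n)) ^ 2) =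
      doubleAppell ((q ^ 3) ^ 3) 1 - 2 * q * doubleAppell ((q ^ 3) ^ 3) (q ^ 3) := by
  have hnq : 0 < ‖q‖ := norm_pos_iff.2 hq0
  set f : ℤ → ℂ := fun n ↦ (-1 : ℂ) ^ n * q ^ (n ^ 2 + 3 * n) / (1 + q ^ (3 * n)) ^ 2 with hf
  let T : ℂ → ℤ → ℂ := fun x m ↦ (-1) ^ m * ((q ^ 3) ^ 3) ^ (m ^ 2 + m) * x ^ (2 * m + 1) /
    (1 + x * ((q ^ 3) ^ 3) ^ m) ^ 2
  have ht0 : (q ^ 3) ^ 3 ≠ 0 := by simp [hq0]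
  have hsum : ∀ k : ℕ, k ≤ 3 → Summable (T (q ^ k)) := by
    intro k hk
    refine summable_doubleAppell ht0 (s := ‖q‖ ^ 4) ?_ (pow_lt_one₀ hnq.le hq (by norm_num)) ?_ ?_
    · rw [← pow_mul, norm_pow]
      exact pow_lt_pow_right_of_lt_one₀ hnq hq (by norm_num)
    · rw [norm_pow]
      exact pow_lt_pow_right_of_lt_one₀ hnq hq (by omega)
    · rw [norm_pow]
      exact (pow_le_one₀ hnq.le hq.le).trans_lt
        ((one_lt_inv₀ (by positivity)).2 (pow_lt_one₀ hnq.le hq (by norm_num)))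
  have hneg3 : ∀ m : ℤ, (-1 : ℂ) ^ (3 * m) = (-1) ^ m := fun m ↦ by rw [zpow_mul]; norm_num
  have h0 : ∀ m, f (3 * m) = T (q ^ 0) m := by
    intro m
    simp only [f, T]
    rw [hneg3, ← pow_mul, ← zpow_natCast q (3 * 3), ← zpow_mul, ← zpow_mul, pow_zero, one_zpow,
      mul_one, one_mul]
    push_cast
    ring_nf
  have h1 : ∀ m, f (3 * m + 1) = -q * T (q ^ 3) m := by
    intro m
    simp only [f, T]
    have e1 : q ^ ((3 * m + 1) ^ 2 + 3 * (3 * m + 1)) =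
        q * (((q ^ 3) ^ 3) ^ (m ^ 2 + m) * (q ^ 3) ^ (2 * m + 1)) := by
      rw [← pow_mul, ← zpow_natCast q (3 * 3), ← zpow_natCast q 3, ← zpow_mul, ← zpow_mul,
        ← zpow_add₀ hq0, ← zpow_one_add₀ hq0]
      push_cast
      ring_nf
    have e2 : q ^ (3 * (3 * m + 1)) = q ^ 3 * ((q ^ 3) ^ 3) ^ m := by
      rw [← pow_mul, ← zpow_natCast q (3 * 3), ← zpow_natCast q 3, ← zpow_mul, ← zpow_add₀ hq0]
      push_cast
      ring_nf
    rw [zpow_add_one₀ (by norm_num), hneg3, e1, e2]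
    ring
  have hsymm : ∀ n, f (-n) = f n := by
    intro n
    simp only [f]
    have e1 : q ^ ((-n) ^ 2 + 3 * -n) = q ^ (n ^ 2 + 3 * n) * (q ^ (3 * -n)) ^ 2 := by
      rw [← zpow_natCast (q ^ (3 * -n)), ← zpow_mul, ← zpow_add₀ hq0]
      push_cast
      ring_nf
    have e2 : 1 + q ^ (3 * -n) = q ^ (3 * -n) * (1 + q ^ (3 * n)) := by
      rw [mul_add, ← zpow_add₀ hq0]
      simp [add_comm]
    have e3 : q ^ (3 * -n) ≠ 0 := zpow_ne_zero _ hq0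
    have e4 : (-1 : ℂ) ^ (-n) = (-1) ^ n := by rw [zpow_neg, ← inv_zpow]; norm_num
    rw [e1, e2, e4, mul_pow, ← mul_assoc, mul_comm ((q ^ (3 * -n)) ^ 2) (_ ^ 2),
      mul_div_mul_right _ _ (pow_ne_zero 2 e3)]
  let e : ℤ ≃ ℤ := (Equiv.neg ℤ).trans (Equiv.subRight 1)
  have h2 : ∀ m, f (3 * m + 2) = -q * T (q ^ 3) (e m) := by
    intro m
    rw [← h1, ← hsymm]
    congr 1
    simp [e]
    ring
  have hs0 : Summable fun m ↦ f (3 * m) := by simpa only [h0] using hsum 0 (by norm_num)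
  have hs1 : Summable fun m ↦ f (3 * m + 1) := by
    simpa only [h1] using (hsum 3 le_rfl).mul_left (-q)
  have hs2 : Summable fun m ↦ f (3 * m + 2) := by
    simp only [h2]
    exact ((hsum 3 le_rfl).comp_injective e.injective).mul_left (-q)
  let E : Fin 3 × ℤ ≃ ℤ := (Equiv.prodComm _ _).trans (Int.divModEquiv 3).symm
  have hE : ∀ i m, E (i, m) = 3 * m + (i : ℕ) := fun i m ↦ by
    simp [E, Int.divModEquiv]
    ring
  have hcomp : ∀ i : Fin 3, Summable fun m ↦ f (E (i, m)) := by
    intro i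
    simp only [hE]
    fin_cases i
    · simpa using hs0
    · simpa using hs1
    · simpa using hs2
  have hsE : Summable fun x ↦ f (E x) := by
    refine Summable.of_norm ((summable_prod_of_nonneg fun _ ↦ norm_nonneg _).2
      ⟨fun i ↦ (hcomp i).norm, Summable.of_finite⟩)
  rw [← E.tsum_eq, hsE.tsum_prod' hcomp, tsum_fintype, Fin.sum_univ_three]
  simp only [hE]
  have t0 : ∑' m, f (3 * m + ((0 : Fin 3) : ℕ)) = doubleAppell ((q ^ 3) ^ 3) 1 := by
    have h (m) : f (3 * m + ((0 : Fin 3) : ℕ)) = T 1 m := by simpa using h0 m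
    exact tsum_congr h
  have t1 : ∑' m, f (3 * m + ((1 : Fin 3) : ℕ)) = -q * doubleAppell ((q ^ 3) ^ 3) (q ^ 3) := by
    rw [doubleAppell, ← tsum_mul_left]
    exact tsum_congr h1
  have t2 : ∑' m, f (3 * m + ((2 : Fin 3) : ℕ)) = -q * doubleAppell ((q ^ 3) ^ 3) (q ^ 3) := by
    change _ = -q * ∑' m, T (q ^ 3) m
    rw [← e.tsum_eq (T (q ^ 3)), ← tsum_mul_left]
    exact tsum_congr h2
  rw [t0, t1, t2]
  ring

/-- The value of `appellDiff` at the cube root `p` of the nome `t = p ^ 3`, as a product of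
`a i = (p ^ i; p ^ 6)_∞`. -/
lemma appellDiff_cube {p : ℂ} (hp0 : p ≠ 0) (hp : ‖p‖ < 1) {a : ℕ → ℂ}
    (ha : ∀ i, a i = poch (p ^ i) (p ^ 6)) :
    4 * (doubleAppell (p ^ 3) p * a 3 ^ 2 - doubleAppell (p ^ 3) 1 * (a 1 * a 5)) =
      -(a 1 ^ 5 * a 5 ^ 5 * a 2 ^ 2 * a 4 ^ 2 * a 3 ^ 8 * a 6 ^ 4) := by
  have hnp : 0 < ‖p‖ := norm_pos_iff.2 hp0
  have ht : ‖p ^ 3‖ < 1 := by rw [norm_pow]; exact pow_lt_one₀ hnp.le hp (by norm_num)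
  have h6 : ‖p ^ 6‖ < 1 := by rw [norm_pow]; exact pow_lt_one₀ hnp.le hp (by norm_num)
  have hne : ∀ i ≠ 0, a i ≠ 0 := fun i hi ↦ by
    rw [ha]
    refine poch_ne_zero_of_norm_lt_one h6 ?_
    rw [norm_pow]
    exact pow_lt_one₀ hnp.le hp hi
  have hp1 : p ≠ 1 := by rintro rfl; simp at hp
  have hp1' : p ≠ -1 := by rintro rfl; simp at hp
  have key := appellDiff_mul_theta_sq (pow_ne_zero 3 hp0) ht
    (by rw [norm_pow]; simpa using pow_lt_pow_right_of_lt_one₀ hnp hp (by norm_num : 1 < 3))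
    hp.le hp1 hp1'
    (fun h ↦ hp1 (mul_left_cancel₀ (pow_ne_zero 2 hp0) (by linear_combination -h)))
  have s1 : poch p (p ^ 3) = a 1 * a 4 := by
    rw [poch_even_mul_odd _ ht, ha, ha]
    ring_nf
  have s2 : poch (p ^ 2) (p ^ 3) = a 2 * a 5 := by
    rw [poch_even_mul_odd _ ht, ha, ha]
    ring_nf
  have s3 : poch (p ^ 3) (p ^ 3) = a 3 * a 6 := by
    rw [poch_even_mul_odd _ ht, ha, ha]
    ring_nf
  have n1 : a 1 * a 4 * poch (-p) (p ^ 3) = a 2 := by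
    rw [← s1, poch_mul_poch_neg _ ht, ha]
    ring_nf
  have n2 : a 2 * a 5 * poch (-p ^ 2) (p ^ 3) = a 4 := by
    rw [← s2, poch_mul_poch_neg _ ht, ha]
    ring_nf
  have n3 : a 3 * a 6 * poch (-p ^ 3) (p ^ 3) = a 6 := by
    rw [← s3, poch_mul_poch_neg _ ht, ha]
    ring_nf
  have d1 : p ^ 3 / p = p ^ 2 := by field_simp
  have d2 : p ^ 3 / -p = -p ^ 2 := by field_simp
  have d3 : p ^ 3 / p ^ 2 = p := by field_simp
  have θ1 : theta (p ^ 3) p = a 1 * a 4 * (a 2 * a 5) := by rw [theta, d1, s1, s2]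
  have θ2 : theta (p ^ 3) (-p) = poch (-p) (p ^ 3) * poch (-p ^ 2) (p ^ 3) := by rw [theta, d2]
  have θ3 : theta (p ^ 3) (-1) = 2 * poch (-p ^ 3) (p ^ 3) ^ 2 := by
    rw [theta_eq _ ht, neg_one_mul, div_neg, div_one]
    ring
  have σ1 : thetaSq (p ^ 3) 1 = a 3 ^ 2 := by
    rw [thetaSq, ha]
    ring_nf
  have σ2 : thetaSq (p ^ 3) p = a 1 * a 5 := by
    rw [thetaSq, d3, ha, ha]
    ring_nf
  rw [appellDiff, θ1, θ2, θ3, σ1, σ2, s3] at key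
  have m1 : poch (-p) (p ^ 3) = a 2 / (a 1 * a 4) := by
    rw [eq_div_iff (mul_ne_zero (hne 1 (by simp)) (hne 4 (by simp))), ← n1]; ring
  have m2 : poch (-p ^ 2) (p ^ 3) = a 4 / (a 2 * a 5) := by
    rw [eq_div_iff (mul_ne_zero (hne 2 (by simp)) (hne 5 (by simp))), ← n2]; ring
  have m3 : poch (-p ^ 3) (p ^ 3) = 1 / a 3 := by
    rw [eq_div_iff (hne 3 (by simp))]
    exact mul_left_cancel₀ (hne 6 (by simp)) (by linear_combination n3)
  rw [m1, m2, m3] at key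
  have i1 := hne 1 (by simp)
  have i2 := hne 2 (by simp)
  have i3 := hne 3 (by simp)
  have i4 := hne 4 (by simp)
  have i5 := hne 5 (by simp)
  generalize hX : doubleAppell (p ^ 3) p * a 3 ^ 2 - doubleAppell (p ^ 3) 1 * (a 1 * a 5) = X
    at key ⊢
  field_simp at key
  linear_combination key

theorem stmt17 (q : ℂ) (hq0 : 0 < ‖q‖) (hq : ‖q‖ < 1)
    (hden : ∀ m : ℤ, q ^ m ≠ -1) :
    (∑' n : ℤ, (-1 : ℂ) ^ n * q ^ (n ^ 2 + 3 * n) / (1 + q ^ (3 * n)) ^ 2)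
      = q * (Jam 3 18 q) ^ 5 * (Jm 6 q) ^ 2 * (Jam 9 18 q) ^ 3 / (2 * (Jm 18 q) ^ 6)
        + (1 - 2 * q * Jam 3 18 q / Jam 9 18 q)
            * (∑' n : ℤ, (-1 : ℂ) ^ n * q ^ (9 * n ^ 2 + 9 * n) / (1 + q ^ (9 * n)) ^ 2) := by
  have hq' : q ≠ 0 := norm_pos_iff.1 hq0
  have hp : ‖q ^ 3‖ < 1 := by rw [norm_pow]; exact pow_lt_one₀ hq0.le hq (by norm_num)
  have h6 : ‖q ^ 6‖ < 1 := by rw [norm_pow]; exact pow_lt_one₀ hq0.le hq (by norm_num)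
  have h18 : ‖(q ^ 3) ^ 6‖ < 1 := by
    rw [norm_pow]
    exact pow_lt_one₀ (norm_nonneg _) hp (by norm_num)
  rw [tsum_eq_doubleAppell hq' hq, ← doubleAppell_pow_eq q]
  obtain ⟨a, ha⟩ : ∃ a : ℕ → ℂ, ∀ i, a i = poch ((q ^ 3) ^ i) ((q ^ 3) ^ 6) := ⟨_, fun _ ↦ rfl⟩
  have key := appellDiff_cube (pow_ne_zero 3 hq') hp ha
  have hne : ∀ i ≠ 0, a i ≠ 0 := fun i hi ↦ by
    rw [ha]
    refine poch_ne_zero_of_norm_lt_one h18 ?_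
    rw [norm_pow]
    exact pow_lt_one₀ (norm_nonneg _) hp hi
  have j3 : Jam 3 18 q = a 1 * a 5 * a 6 := by
    simp only [Jam, ha, ← pow_mul]
  have j9 : Jam 9 18 q = a 3 * a 3 * a 6 := by
    simp only [Jam, ha, ← pow_mul]
  have j18 : Jm 18 q = a 6 := by
    simp only [Jm, ha, ← pow_mul]
  have j6 : Jm 6 q = a 2 * a 4 * a 6 := by
    rw [Jm, poch_split_three _ h6]
    simp only [ha, ← pow_mul, ← pow_add]
  rw [j3, j9, j18, j6]
  have i3 := hne 3 (by simp)
  have i6 := hne 6 (by simp)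
  generalize doubleAppell ((q ^ 3) ^ 3) 1 = u at key ⊢
  generalize doubleAppell ((q ^ 3) ^ 3) (q ^ 3) = v at key ⊢
  field_simp
  linear_combination (-q) * key
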